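/- Assume G is connected, G[supp μ] is not connected, supp μ ≠ S, and N ≥ 3, and let c_N = 1/(2(N−1)^2). Then for every integer k > k̄, the constant p in the construction of P^{(μ_k,G)} satisfies p ≥ c_N/k, and consequently every nonzero entry of P^{(μ_k,G)} is at least c_N/k. -/

import Mathlib

open Finset

attribute [local instance] Classical.propDecidable

/-- `k̄ = ⌈1 / min{μ(s) : s ∈ S, μ(s) > 0}⌉`. -/
noncomputable def suppMinCeil {N : ℕ} (μ : Fin N → ℝ) : ℕ :=
  ⌈1 / sInf (μ '' {s | 0 < μ s})⌉₊

/-- `A_k = {s ∈ S : μ(s) < 1/k}`. -/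
noncomputable def Ak {N : ℕ} (μ : Fin N → ℝ) (k : ℕ) : Finset (Fin N) :=
  Finset.univ.filter fun s => μ s < 1 / (k : ℝ)

/-- `η_k`, the uniform distribution on `A_k`. -/
noncomputable def etak {N : ℕ} (μ : Fin N → ℝ) (k : ℕ) : Fin N → ℝ :=
  fun s => if s ∈ Ak μ k then 1 / ((Ak μ k).card : ℝ) else 0

/-- `μ_k = (1/k) η_k + ((k-1)/k) μ`. -/
noncomputable def muk {N : ℕ} (μ : Fin N → ℝ) (k : ℕ) : Fin N → ℝ :=
  fun s => (1 / (k : ℝ)) * etak μ k s + (((k : ℝ) - 1) / k) * μ s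

/-- The denominator appearing in the definition of the constant `p`:
`Σ_{m>l} 1_{{s^l,s^m} ∈ E} + Σ_{m<l} (ν(s^m)/ν(s^l)) 1_{{s^l,s^m} ∈ E}`. -/
noncomputable def denomP {V : Type*} [Fintype V] [LinearOrder V]
    (G : SimpleGraph V) (ν : V → ℝ) (l : V) : ℝ :=
  (∑ m, if l < m ∧ G.Adj l m then (1 : ℝ) else 0)
    + ∑ m, if m < l ∧ G.Adj l m then ν m / ν l else 0

/-- The constant `p = min_l 1/(2 · denom(l))`. -/
noncomputable def pconst {V : Type*} [Fintype V] [LinearOrder V]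
    (G : SimpleGraph V) (ν : V → ℝ) : ℝ :=
  ⨅ l, 1 / (2 * denomP G ν l)

/-- The transition matrix `P^{(ν,G)}`. -/
noncomputable def Pmat {V : Type*} [Fintype V] [LinearOrder V]
    (G : SimpleGraph V) (ν : V → ℝ) : Matrix V V ℝ :=
  Matrix.of fun l m =>
    if l = m then 1 - pconst G ν * denomP G ν l
    else if l < m ∧ G.Adj l m then pconst G ν
    else if m < l ∧ G.Adj l m then (ν m / ν l) * pconst G ν
    else 0

theorem denomP_pos {V : Type*} [Fintype V] [LinearOrder V] {G : SimpleGraph V} {ν : V → ℝ}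
    (hν : ∀ s, 0 < ν s) {l m : V} (h : G.Adj l m) : 0 < denomP G ν l := by
  have h1 : ∀ x ∈ (univ : Finset V), 0 ≤ (if l < x ∧ G.Adj l x then (1 : ℝ) else 0) := by
    intro x _; split_ifs <;> simp
  have h2 : ∀ x ∈ (univ : Finset V), 0 ≤ (if x < l ∧ G.Adj l x then ν x / ν l else 0) := by
    intro x _
    have := div_pos (hν x) (hν l)
    split_ifs <;> simp [this.le]
  unfold denomP
  rcases lt_or_gt_of_ne h.ne with hlm | hlm
  · refine add_pos_of_pos_of_nonneg (sum_pos' h1 ⟨m, mem_univ m, ?_⟩) (sum_nonneg h2)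
    simp [hlm, h]
  · refine add_pos_of_nonneg_of_pos (sum_nonneg h1) (sum_pos' h2 ⟨m, mem_univ m, ?_⟩)
    rw [if_pos ⟨hlm, h⟩]
    exact div_pos (hν m) (hν l)

theorem denomP_le {V : Type*} [Fintype V] [LinearOrder V] (G : SimpleGraph V) {ν : V → ℝ}
    {l : V} {C : ℝ} (hC : 1 ≤ C) (hl : ∀ m, ν m / ν l ≤ C) :
    denomP G ν l ≤ ((Fintype.card V : ℝ) - 1) * C := by
  have h : denomP G ν l ≤ ∑ m ∈ univ.erase l, C := by
    unfold denomP
    rw [← sum_add_distrib, ← add_sum_erase univ _ (mem_univ l)]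
    simp only [lt_irrefl, false_and, if_false, add_zero, zero_add]
    refine sum_le_sum fun m _ => ?_
    have := hl m
    split_ifs with h1 h2 h2
    · exact absurd h1.1 h2.1.asymm
    all_goals linarith
  rw [sum_const, card_erase_of_mem (mem_univ l), card_univ, nsmul_eq_mul,
    Nat.cast_sub (Fintype.card_pos_iff.2 ⟨l⟩), Nat.cast_one] at h
  exact h

theorem pconst_le {V : Type*} [Fintype V] [LinearOrder V] (G : SimpleGraph V) (ν : V → ℝ)
    (l : V) : pconst G ν ≤ 1 / (2 * denomP G ν l) :=
  ciInf_le (Set.finite_range _).bddBelow l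

theorem Pmat_ge {V : Type*} [Fintype V] [LinearOrder V] {G : SimpleGraph V} {ν : V → ℝ}
    (hν : ∀ s, 0 < ν s) (hanti : Antitone ν) {c : ℝ} (hc : c ≤ 1 / 2)
    (hp0 : 0 < pconst G ν) (hp : c ≤ pconst G ν) {l m : V} (h : Pmat G ν l m ≠ 0)
    (hd : 0 < denomP G ν l) : c ≤ Pmat G ν l m := by
  unfold Pmat at h ⊢
  rw [Matrix.of_apply] at h ⊢
  split_ifs at h ⊢ with h1 h2 h3
  · have := pconst_le G ν l
    rw [le_div_iff₀ (by positivity)] at this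
    linarith
  · exact hp
  · exact hp.trans (le_mul_of_one_le_left hp0.le ((one_le_div (hν l)).2 (hanti h3.1.le)))
  · exact absurd rfl h

theorem one_le_sub_one_mul {N : ℕ} {μ : Fin N → ℝ} {k : ℕ} (hk : suppMinCeil μ < k)
    {s : Fin N} (hs : 0 < μ s) : 1 ≤ ((k : ℝ) - 1) * μ s := by
  have hfin : (μ '' {s | 0 < μ s}).Finite := Set.toFinite _
  obtain ⟨t, ht, hte⟩ := Set.Nonempty.csInf_mem (Set.Nonempty.image μ ⟨s, hs⟩) hfin
  have hle : sInf (μ '' {s | 0 < μ s}) ≤ μ s := csInf_le hfin.bddBelow ⟨s, hs, rfl⟩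
  have hpos : 0 < sInf (μ '' {s | 0 < μ s}) := hte ▸ ht
  have hceil : 1 / sInf (μ '' {s | 0 < μ s}) ≤ (suppMinCeil μ : ℝ) := Nat.le_ceil _
  have hk' : (suppMinCeil μ : ℝ) + 1 ≤ k := by exact_mod_cast hk
  exact (div_le_iff₀ hs).1 ((one_div_le_one_div_of_le hpos hle).trans (by linarith))

theorem mem_Ak_iff {N : ℕ} {μ : Fin N → ℝ} (hμ0 : ∀ s, 0 ≤ μ s) {k : ℕ}
    (hk : suppMinCeil μ < k) {s : Fin N} : s ∈ Ak μ k ↔ μ s = 0 := by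
  have hk0 : (0 : ℝ) < k := by exact_mod_cast (Nat.zero_le _).trans_lt hk
  simp only [Ak, mem_filter, mem_univ, true_and]
  refine ⟨fun h => ?_, fun h => by rw [h]; positivity⟩
  by_contra hne
  have hs := lt_of_le_of_ne (hμ0 s) (Ne.symm hne)
  have := one_le_sub_one_mul hk hs
  rw [lt_div_iff₀ hk0] at h
  linarith

theorem muk_of_eq_zero {N : ℕ} {μ : Fin N → ℝ} (hμ0 : ∀ s, 0 ≤ μ s) {k : ℕ}
    (hk : suppMinCeil μ < k) {s : Fin N} (hs : μ s = 0) :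
    muk μ k s = 1 / (k * (Ak μ k).card) := by
  rw [muk, etak, if_pos ((mem_Ak_iff hμ0 hk).2 hs), hs, mul_zero, add_zero, one_div_mul_one_div]

theorem muk_of_pos {N : ℕ} {μ : Fin N → ℝ} (hμ0 : ∀ s, 0 ≤ μ s) {k : ℕ}
    (hk : suppMinCeil μ < k) {s : Fin N} (hs : 0 < μ s) :
    muk μ k s = ((k : ℝ) - 1) * μ s / k := by
  rw [muk, etak, if_neg (fun h => hs.ne' ((mem_Ak_iff hμ0 hk).1 h))]
  ring

theorem one_div_le_muk {N : ℕ} {μ : Fin N → ℝ} (hμ0 : ∀ s, 0 ≤ μ s) {k : ℕ}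
    (hk : suppMinCeil μ < k) {s : Fin N} (hs : 0 < μ s) : 1 / (k : ℝ) ≤ muk μ k s := by
  rw [muk_of_pos hμ0 hk hs]
  exact div_le_div_of_nonneg_right (one_le_sub_one_mul hk hs) (Nat.cast_nonneg k)

theorem muk_le_of_eq_zero {N : ℕ} {μ : Fin N → ℝ} (hμ0 : ∀ s, 0 ≤ μ s) {k : ℕ}
    (hk : suppMinCeil μ < k) {s : Fin N} (hs : μ s = 0) : muk μ k s ≤ 1 / (k : ℝ) := by
  have hk0 : (0 : ℝ) < k := by exact_mod_cast (Nat.zero_le _).trans_lt hk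
  have hc : (1 : ℝ) ≤ (Ak μ k).card := by
    exact_mod_cast card_pos.2 ⟨s, (mem_Ak_iff hμ0 hk).2 hs⟩
  rw [muk_of_eq_zero hμ0 hk hs]
  exact one_div_le_one_div_of_le hk0 (le_mul_of_one_le_right hk0.le hc)

theorem muk_antitone {N : ℕ} {μ : Fin N → ℝ} (hμ0 : ∀ s, 0 ≤ μ s) (hμ : Antitone μ) {k : ℕ}
    (hk : suppMinCeil μ < k) : Antitone (muk μ k) := by
  have hk1 : (1 : ℝ) ≤ k := by exact_mod_cast (Nat.zero_le _).trans_lt hk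
  intro l m hlm
  rcases (hμ0 m).eq_or_lt with hm | hm
  · rcases (hμ0 l).eq_or_lt with hl | hl
    · rw [muk_of_eq_zero hμ0 hk hm.symm, muk_of_eq_zero hμ0 hk hl.symm]
    · exact (muk_le_of_eq_zero hμ0 hk hm.symm).trans (one_div_le_muk hμ0 hk hl)
  · rw [muk_of_pos hμ0 hk hm, muk_of_pos hμ0 hk (hm.trans_le (hμ hlm))]
    exact div_le_div_of_nonneg_right
      (mul_le_mul_of_nonneg_left (hμ hlm) (by linarith)) (by linarith)

theorem muk_le_one {N : ℕ} {μ : Fin N → ℝ} (hμ0 : ∀ s, 0 ≤ μ s) (hμ1 : ∑ s, μ s = 1) {k : ℕ}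
    (hk : suppMinCeil μ < k) (s : Fin N) : muk μ k s ≤ 1 := by
  have hk1 : (1 : ℝ) ≤ k := by exact_mod_cast (Nat.zero_le _).trans_lt hk
  rcases (hμ0 s).eq_or_lt with hs | hs
  · exact (muk_le_of_eq_zero hμ0 hk hs.symm).trans ((div_le_one (by linarith)).2 hk1)
  · rw [muk_of_pos hμ0 hk hs, div_le_one (by linarith)]
    have : μ s ≤ 1 := hμ1 ▸ single_le_sum (fun i _ => hμ0 i) (mem_univ s)
    nlinarith

theorem le_muk {N : ℕ} (hN : 2 ≤ N) {μ : Fin N → ℝ} (hμ0 : ∀ s, 0 ≤ μ s)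
    (hμ1 : ∑ s, μ s = 1) {k : ℕ} (hk : suppMinCeil μ < k) (s : Fin N) :
    1 / (k * ((N : ℝ) - 1)) ≤ muk μ k s := by
  have hk0 : (0 : ℝ) < k := by exact_mod_cast (Nat.zero_le _).trans_lt hk
  have hN' : (2 : ℝ) ≤ N := by exact_mod_cast hN
  rcases (hμ0 s).eq_or_lt with hs | hs
  · rw [muk_of_eq_zero hμ0 hk hs.symm]
    have hc : (0 : ℝ) < (Ak μ k).card := by
      exact_mod_cast card_pos.2 ⟨s, (mem_Ak_iff hμ0 hk).2 hs.symm⟩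
    obtain ⟨t, -, ht⟩ : ∃ t ∈ univ, μ t ≠ 0 :=
      exists_ne_zero_of_sum_ne_zero (by rw [hμ1]; exact one_ne_zero)
    have hlt : (Ak μ k).card < N := by
      simpa using card_lt_card
        (ssubset_univ_iff.2 fun h : Ak μ k = univ =>
          ht ((mem_Ak_iff hμ0 hk).1 (h ▸ mem_univ t)))
    have hlt' : ((Ak μ k).card : ℝ) + 1 ≤ N := by exact_mod_cast hlt
    exact one_div_le_one_div_of_le (by positivity)
      (mul_le_mul_of_nonneg_left (by linarith) hk0.le)
  · refine le_trans (one_div_le_one_div_of_le hk0 ?_) (one_div_le_muk hμ0 hk hs)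
    exact le_mul_of_one_le_right hk0.le (by linarith)

theorem stmt_6 {N : ℕ} (hN : 3 ≤ N) (G : SimpleGraph (Fin N)) (hG : G.Connected)
    (μ : Fin N → ℝ) (hμ0 : ∀ s, 0 ≤ μ s) (hμ1 : ∑ s, μ s = 1)
    (hord : ∀ l m : Fin N, l ≤ m → μ m ≤ μ l)
    (hsupp : ¬ (G.induce {s : Fin N | 0 < μ s}).Connected)
    (hne : {s : Fin N | 0 < μ s} ≠ Set.univ)
    (cN : ℝ) (hcN : cN = 1 / (2 * ((N : ℝ) - 1) ^ 2))
    (k : ℕ) (hk : suppMinCeil μ < k) :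
    cN / k ≤ pconst G (muk μ k) ∧
    ∀ l m : Fin N, Pmat G (muk μ k) l m ≠ 0 → cN / k ≤ Pmat G (muk μ k) l m := by
  have hk1 : (1 : ℝ) ≤ k := by exact_mod_cast (Nat.zero_le _).trans_lt hk
  have hN' : (2 : ℝ) ≤ (N : ℝ) - 1 := by
    have : (3 : ℝ) ≤ N := by exact_mod_cast hN
    linarith
  have hkN : 0 < (k : ℝ) * ((N : ℝ) - 1) := by positivity
  have hlow := le_muk (by omega) hμ0 hμ1 hk
  have hν : ∀ s, 0 < muk μ k s := fun s => (one_div_pos.2 hkN).trans_le (hlow s)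
  have : Nontrivial (Fin N) := Fin.nontrivial_iff_two_le.2 (by omega)
  have hd : ∀ l, 0 < denomP G (muk μ k) l := fun l =>
    denomP_pos hν (hG.preconnected.exists_adj_of_nontrivial l).choose_spec
  have hratio : ∀ l m, muk μ k m / muk μ k l ≤ k * ((N : ℝ) - 1) := by
    intro l m
    rw [div_le_iff₀ (hν l)]
    exact (muk_le_one hμ0 hμ1 hk m).trans ((div_le_iff₀' hkN).1 (hlow l))
  have hc : cN / k = 1 / (2 * (((N : ℝ) - 1) * (k * ((N : ℝ) - 1)))) := by
    rw [hcN, div_div]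
    congr 1
    ring
  have hc0 : 0 < cN / k := by rw [hc]; positivity
  have hp : cN / k ≤ pconst G (muk μ k) := by
    refine le_ciInf fun l => ?_
    rw [hc]
    have := denomP_le G (by nlinarith) (hratio l)
    rw [Fintype.card_fin] at this
    exact one_div_le_one_div_of_le (mul_pos two_pos (hd l)) (by linarith)
  have hc2 : cN / k ≤ 1 / 2 := by
    rw [hc]
    exact one_div_le_one_div_of_le two_pos (by nlinarith)
  exact ⟨hp, fun l m h => Pmat_ge hν
    (muk_antitone hμ0 (fun l m hlm => hord l m hlm) hk) hc2 (hc0.trans_le hp) hp h (hd l)⟩
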